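/- (Quantitative lower bound for the Fourier transform gap.) Let M > 0 and let f : ℝ³ → [0,∞) be measurable with ‖⟨·⟩³ f‖_{L²(ℝ³)} ≤ M. Then there exists a constant C_M > 0 depending only on M such that for every ξ ∈ ℝ³, F(f)(0) − |F(f)(ξ)| ≥ C_M ‖f‖_{L¹(ℝ³)}^{11} (|ξ|² · 1_{|ξ|≤1} + 1_{|ξ|>1}), where F(f)(ξ) := ∫_{ℝ³} f(v) e^{−2πi v·ξ} dv. -/

import Mathlib

open MeasureTheory Real Filter Function Set
open scoped ENNReal Topology RealInnerProductSpace FourierTransform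

noncomputable section

abbrev V3 : Type := EuclideanSpace ℝ (Fin 3)
abbrev X3 : Type := Fin 3 → ℝ

/-- Japanese bracket `⟨v⟩ = (1+|v|²)^{1/2}`. -/
def jap (v : V3) : ℝ := Real.sqrt (1 + ‖v‖ ^ 2)

/-- `⟨q⟩` for integer frequencies `q ∈ ℤ³`. -/
def japZ (m : Fin 3 → ℤ) : ℝ := Real.sqrt (1 + ∑ i, (m i : ℝ) ^ 2)

/-- Fundamental domain of the torus `T³`. -/
def cube : Set X3 := Set.Icc 0 1

/-- Surface measure on the unit sphere `S² ⊂ ℝ³`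
(two–dimensional Hausdorff measure restricted to the sphere). -/
def sphMeas : Measure V3 :=
  (MeasureTheory.Measure.hausdorffMeasure 2 : Measure V3).restrict (Metric.sphere 0 1)

/-- Post-collisional velocity `v' = (v+v_*)/2 + (|v-v_*|/2)σ`. -/
def vPost (v vs σ : V3) : V3 := (2 : ℝ)⁻¹ • (v + vs) + (‖v - vs‖ / 2) • σ

/-- Post-collisional velocity `v'_* = (v+v_*)/2 − (|v-v_*|/2)σ`. -/
def vsPost (v vs σ : V3) : V3 := (2 : ℝ)⁻¹ • (v + vs) - (‖v - vs‖ / 2) • σ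

/-- Boltzmann collision kernel `B(u,σ) = |u|^γ b((u/|u|)·σ)`. -/
def Bker (γ : ℝ) (b : ℝ → ℝ) (u σ : V3) : ℝ := ‖u‖ ^ γ * b ⟪‖u‖⁻¹ • u, σ⟫

/-- Assumptions on the non-cutoff angular kernel `b` with singularity exponent `1+2s`. -/
structure AngularKernel (s : ℝ) (b : ℝ → ℝ) : Prop where
  nonneg : ∀ t, 0 ≤ b t
  vanish : ∀ t : ℝ, t < 0 → b t = 0
  bounds : ∃ C > (0 : ℝ), ∀ θ ∈ Set.Ioc (0 : ℝ) (π / 2),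
    C * θ ^ (-1 - 2 * s) ≤ Real.sin θ * b (Real.cos θ) ∧
      Real.sin θ * b (Real.cos θ) ≤ C⁻¹ * θ ^ (-1 - 2 * s)

/-- Boltzmann collision operator `Q(g,f)`. -/
def Qop (γ : ℝ) (b : ℝ → ℝ) (g f : V3 → ℝ) (v : V3) : ℝ :=
  ∫ vs, (∫ σ, Bker γ b (v - vs) σ *
    (g (vsPost v vs σ) * f (vPost v vs σ) - g vs * f v) ∂sphMeas)

/-- Cutoff collision operator `Q_ε(g,f)`, with the deviation angle `θ ≥ ε`. -/
def Qeps (γ : ℝ) (b : ℝ → ℝ) (ε : ℝ) (g f : V3 → ℝ) (v : V3) : ℝ :=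
  ∫ vs, (∫ σ, (if ⟪‖v - vs‖⁻¹ • (v - vs), σ⟫ ≤ Real.cos ε then
    Bker γ b (v - vs) σ * (g (vsPost v vs σ) * f (vPost v vs σ) - g vs * f v)
    else 0) ∂sphMeas)

/-- Weighted `L^p_l` norm `‖⟨·⟩^l f‖_{L^p}` (extended-real valued). -/
def wLp (p : ℝ≥0∞) (l : ℝ) (f : V3 → ℂ) : ℝ≥0∞ :=
  eLpNorm (fun v => jap v ^ l • f v) p volume

/-- Weighted Sobolev norm `‖f‖_{H^m_l} = ‖⟨D⟩^m (⟨·⟩^l f)‖_{L²}`, computed on the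
Fourier side via Plancherel. -/
def sobN (m l : ℝ) (f : V3 → ℂ) : ℝ≥0∞ :=
  eLpNorm (fun ξ => jap ξ ^ m • 𝓕 (fun v => jap v ^ l • f v) ξ) 2 volume

/-- Character `e^{2πi m·x}` on the torus. -/
def eX (m : Fin 3 → ℤ) (x : X3) : ℂ :=
  Complex.exp (((2 * π * ∑ i, (m i : ℝ) * x i : ℝ) : ℂ) * Complex.I)

/-- Fourier coefficient in the space variable: `F_x(f)(m,v) = ∫_{T³} e^{-2πim·x} f(x,v) dx`. -/
def Fx (f : X3 → V3 → ℂ) (m : Fin 3 → ℤ) : V3 → ℂ :=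
  fun v => ∫ x in cube, (eX m x)⁻¹ * f x v

def toC (f : X3 → V3 → ℝ) : X3 → V3 → ℂ := fun x v => (f x v : ℂ)
def toC1 (f : V3 → ℝ) : V3 → ℂ := fun v => (f v : ℂ)

/-- Squared mixed norm `‖f‖²_{H^n_x X} = Σ_q ⟨q⟩^{2n} ‖F_x(f)(q,·)‖²_X`. -/
def hxNSq (n : ℝ) (N : (V3 → ℂ) → ℝ≥0∞) (f : X3 → V3 → ℂ) : ℝ≥0∞ :=
  ∑' q : Fin 3 → ℤ, ENNReal.ofReal (japZ q ^ (2 * n)) * N (Fx f q) ^ 2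

/-- Squared `H^n_x H^m_l` norm. -/
def hxSobSq (n m l : ℝ) (f : X3 → V3 → ℂ) : ℝ≥0∞ := hxNSq n (sobN m l) f

/-- Squared `H^n_x L²_l` norm. -/
def hxL2Sq (n l : ℝ) (f : X3 → V3 → ℂ) : ℝ≥0∞ := hxNSq n (wLp 2 l) f

/-- `L^∞_x L²_l` norm. -/
def linfxL2 (l : ℝ) (f : X3 → V3 → ℝ) : ℝ≥0∞ :=
  essSup (fun x => wLp 2 l fun v => (f x v : ℂ)) volume

/-- A dyadic partition of unity `ψ, φ` on `ℝ³`, as used for the Littlewood–Paley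
decompositions in phase and frequency space. -/
structure DyadicPartition (ψv φv : V3 → ℝ) : Prop where
  smooth_psi : ContDiff ℝ ((⊤ : ℕ∞) : WithTop ℕ∞) ψv
  smooth_phi : ContDiff ℝ ((⊤ : ℕ∞) : WithTop ℕ∞) φv
  nonneg_psi : ∀ ξ, 0 ≤ ψv ξ
  nonneg_phi : ∀ ξ, 0 ≤ φv ξ
  radial_psi : ∀ ξ η : V3, ‖ξ‖ = ‖η‖ → ψv ξ = ψv η
  radial_phi : ∀ ξ η : V3, ‖ξ‖ = ‖η‖ → φv ξ = φv η
  supp_psi : ∀ ξ : V3, 4 / 3 < ‖ξ‖ → ψv ξ = 0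
  supp_phi : ∀ ξ : V3, (‖ξ‖ < 3 / 4 ∨ 8 / 3 < ‖ξ‖) → φv ξ = 0
  partition : ∀ ξ : V3, ψv ξ + ∑' j : ℕ, φv ((2 : ℝ) ^ (-(j : ℝ)) • ξ) = 1

/-- Phase-space localization `P_k f = φ(2^{-k}·) f`, `k ≥ 0`. -/
def Pdy (φv : V3 → ℝ) (k : ℕ) (f : V3 → ℂ) : V3 → ℂ :=
  fun v => (φv ((2 : ℝ) ^ (-(k : ℝ)) • v) : ℂ) * f v

/-- Frequency localization `F_j f = ℱ⁻¹(φ(2^{-j}·) ℱ f)`, `j ≥ 0`. -/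
def Fdy (φv : V3 → ℝ) (j : ℕ) (f : V3 → ℂ) : V3 → ℂ :=
  𝓕⁻ fun ξ => (φv ((2 : ℝ) ^ (-(j : ℝ)) • ξ) : ℂ) * 𝓕 f ξ

/-- Frequency localization indexed by `j ∈ ℤ`, `j ≥ -1`, where `j = -1` uses `ψ`. -/
def FdyZ (ψv φv : V3 → ℝ) (j : ℤ) (f : V3 → ℂ) : V3 → ℂ :=
  𝓕⁻ fun ξ => ((if j = -1 then ψv ξ else φv ((2 : ℝ) ^ (-(j : ℝ)) • ξ)) : ℂ) * 𝓕 f ξ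

/-- The frequencies `m = (±⌊2^{(1-ε)j}⌋, 0, 0) ∈ M_j`. -/
def mIdx (ε : ℝ) (j : ℕ) (sgn : Bool) : Fin 3 → ℤ :=
  fun i => if i = 0 then (if sgn then 1 else -1) * ⌊(2 : ℝ) ^ ((1 - ε) * j)⌋ else 0

/-- The divergent sum in the definition of `R_sd(ℓ;ε,a)` (and of `H^n_sd(ℓ;ε,a)`):
`Σ_{j≥1} Σ_{l>aj} 2^{(2ℓa+2n(1-ε)+ε)j} Σ_{m∈M_j} ‖F_j P_l F_x(f)(m,·)‖²_{L²}`. -/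
def rsdSum (φv : V3 → ℝ) (ℓ ε a n : ℝ) (f : X3 → V3 → ℝ) : ℝ≥0∞ :=
  ∑' j : ℕ, ∑' l : ℕ,
    if 1 ≤ j ∧ a * j < l then
      ENNReal.ofReal ((2 : ℝ) ^ ((2 * ℓ * a + 2 * n * (1 - ε) + ε) * j)) *
        (eLpNorm (Fdy φv j (Pdy φv l (Fx (toC f) (mIdx ε j true)))) 2 volume ^ 2 +
          eLpNorm (Fdy φv j (Pdy φv l (Fx (toC f) (mIdx ε j false)))) 2 volume ^ 2)
    else 0

/-- Membership in the set of typical rough and slowly decaying data `R_sd(ℓ; ε, a)`. -/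
def memRsd (φv : V3 → ℝ) (ℓ ε a : ℝ) (f : X3 → V3 → ℝ) : Prop :=
  (∀ x v, 0 ≤ f x v) ∧ Measurable (fun p : X3 × V3 => f p.1 p.2) ∧
    (∀ (k : Fin 3 → ℤ) (x : X3) (v : V3), f (x + fun i => (k i : ℝ)) v = f x v) ∧
    linfxL2 ℓ f < ⊤ ∧ rsdSum φv ℓ ε a 0 f = ⊤

/-- Membership in the set of regular-in-`x` slowly decaying data `H^n_sd(ℓ; ε, a)`. -/
def memHnsd (φv : V3 → ℝ) (ℓ ε a n : ℝ) (f : X3 → V3 → ℝ) : Prop :=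
  (∀ x v, 0 ≤ f x v) ∧ Measurable (fun p : X3 × V3 => f p.1 p.2) ∧
    (∀ (k : Fin 3 → ℤ) (x : X3) (v : V3), f (x + fun i => (k i : ℝ)) v = f x v) ∧
    hxL2Sq n ℓ (toC f) < ⊤ ∧ rsdSum φv ℓ ε a n f = ⊤

/-- Test functions for the weak formulation of the Boltzmann equation: `C¹_t C²_{x,v}`
(here `C²` in all variables), periodic in `x`, compactly supported in `[0,∞)×T³×ℝ³`. -/
structure TestFn (φ : ℝ → X3 → V3 → ℝ) : Prop where
  smooth : ContDiff ℝ 2 fun p : ℝ × X3 × V3 => φ p.1 p.2.1 p.2.2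
  periodicX : ∀ (t : ℝ) (k : Fin 3 → ℤ) (x : X3) (v : V3),
    φ t (x + fun i => (k i : ℝ)) v = φ t x v
  compactSupp : ∃ R : ℝ, ∀ t x v, (R ≤ t ∨ R ≤ ‖v‖) → φ t x v = 0

/-- Smooth test functions on `ℝ_t × T³ × ℝ³_v`, compactly supported in `(t,v)`. -/
structure TestXV (φ : ℝ → X3 → V3 → ℝ) : Prop where
  smooth : ContDiff ℝ ((⊤ : ℕ∞) : WithTop ℕ∞) fun p : ℝ × X3 × V3 => φ p.1 p.2.1 p.2.2
  periodicX : ∀ (t : ℝ) (k : Fin 3 → ℤ) (x : X3) (v : V3),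
    φ t (x + fun i => (k i : ℝ)) v = φ t x v
  compactSupp : ∃ R : ℝ, ∀ t x v, (R ≤ |t| ∨ R ≤ ‖v‖) → φ t x v = 0

/-- Smooth test functions with time support inside `I`. -/
structure TestXVIn (I : Set ℝ) (φ : ℝ → X3 → V3 → ℝ) : Prop where
  smooth : ContDiff ℝ ((⊤ : ℕ∞) : WithTop ℕ∞) fun p : ℝ × X3 × V3 => φ p.1 p.2.1 p.2.2
  periodicX : ∀ (t : ℝ) (k : Fin 3 → ℤ) (x : X3) (v : V3),
    φ t (x + fun i => (k i : ℝ)) v = φ t x v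
  suppT : ∀ t ∉ I, ∀ x v, φ t x v = 0
  compactSupp : ∃ R : ℝ, ∀ t x v, (R ≤ |t| ∨ R ≤ ‖v‖) → φ t x v = 0

/-- Smooth test functions on `T³ × ℝ³_v`, compactly supported in `v`. -/
structure TestXV0 (φ : X3 → V3 → ℝ) : Prop where
  smooth : ContDiff ℝ ((⊤ : ℕ∞) : WithTop ℕ∞) fun p : X3 × V3 => φ p.1 p.2
  periodicX : ∀ (k : Fin 3 → ℤ) (x : X3) (v : V3), φ (x + fun i => (k i : ℝ)) v = φ x v
  compactV : ∃ R : ℝ, ∀ x v, R ≤ ‖v‖ → φ x v = 0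

def ddt (φ : ℝ → X3 → V3 → ℝ) (t : ℝ) (x : X3) (v : V3) : ℝ :=
  deriv (fun τ => φ τ x v) t

def vGradX (φ : ℝ → X3 → V3 → ℝ) (t : ℝ) (x : X3) (v : V3) : ℝ :=
  fderiv ℝ (fun y => φ t y v) x fun i => v i

/-- Entropy `H(f) = ∫∫ f log f`. -/
def Hfun (f : X3 → V3 → ℝ) : ℝ := ∫ x in cube, ∫ v, f x v * Real.log (f x v)

/-- Entropy dissipation functional `D(f)`. -/
def entDiss (γ : ℝ) (b : ℝ → ℝ) (f : X3 → V3 → ℝ) : ℝ :=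
  (4 : ℝ)⁻¹ * ∫ x in cube, ∫ v, ∫ vs, (∫ σ, Bker γ b (v - vs) σ *
    (f x (vsPost v vs σ) * f x (vPost v vs σ) - f x vs * f x v) *
    Real.log (f x (vsPost v vs σ) * f x (vPost v vs σ) / (f x vs * f x v)) ∂sphMeas)

/-- Product measure on `T³ × ℝ³`. -/
def tvMeas : Measure (X3 × V3) := (volume.restrict cube).prod volume

/-- Product measure on `A × T³ × ℝ³` for a time set `A`. -/
def tcubeMeas (A : Set ℝ) : Measure (ℝ × X3 × V3) :=
  (volume.restrict A).prod ((volume.restrict cube).prod volume)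

/-- Weak solution of the Boltzmann equation `∂_t f + v·∇_x f = Q(f,f)` on `[0,T]×T³×ℝ³`
with initial datum `f₀`. -/
structure IsWeakSolution (γ : ℝ) (b : ℝ → ℝ) (T : ℝ)
    (f₀ : X3 → V3 → ℝ) (f : ℝ → X3 → V3 → ℝ) : Prop where
  init_nonneg : ∀ x v, 0 ≤ f₀ x v
  init_periodicX : ∀ (k : Fin 3 → ℤ) (x : X3) (v : V3), f₀ (x + fun i => (k i : ℝ)) v = f₀ x v
  init_mass : Integrable (fun p : X3 × V3 => f₀ p.1 p.2 * (1 + ‖p.2‖ ^ 2)) tvMeas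
  init_entropy : Integrable (fun p : X3 × V3 => f₀ p.1 p.2 * Real.log (f₀ p.1 p.2)) tvMeas
  nonneg : ∀ t x v, 0 ≤ f t x v
  meas : Measurable fun p : ℝ × X3 × V3 => f p.1 p.2.1 p.2.2
  periodicX : ∀ (t : ℝ) (k : Fin 3 → ℤ) (x : X3) (v : V3),
    f t (x + fun i => (k i : ℝ)) v = f t x v
  bddL1 : ∃ C : ℝ, ∀ᵐ t ∂volume.restrict (Set.Icc 0 T),
    (∫ x in cube, ∫ v, f t x v * (1 + ‖v‖ ^ 2)) ≤ C ∧
      (∫ x in cube, ∫ v, f t x v * |Real.log (f t x v)|) ≤ C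
  massCons : ∀ t ∈ Set.Icc 0 T,
    (∫ x in cube, ∫ v, f t x v) = ∫ x in cube, ∫ v, f₀ x v
  momCons : ∀ t ∈ Set.Icc 0 T,
    (∫ x in cube, ∫ v, f t x v • v : V3) = ∫ x in cube, ∫ v, f₀ x v • v
  energyCons : ∀ t ∈ Set.Icc 0 T,
    (∫ x in cube, ∫ v, f t x v * ‖v‖ ^ 2) = ∫ x in cube, ∫ v, f₀ x v * ‖v‖ ^ 2
  entropyIneq : ∀ T' ∈ Set.Ioc 0 T,
    Hfun (f T') + (∫ t in Set.Icc 0 T', entDiss γ b (f t)) ≤ Hfun f₀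
  weakForm : ∀ φ : ℝ → X3 → V3 → ℝ, TestFn φ → ∀ T' ∈ Set.Icc 0 T,
    Tendsto (fun ε : ℝ => ∫ t in Set.Icc 0 T', ∫ x in cube, ∫ v,
        Qeps γ b ε (f t x) (f t x) v * φ t x v) (𝓝[>] 0)
      (𝓝 ((∫ x in cube, ∫ v, f T' x v * φ T' x v) -
          (∫ x in cube, ∫ v, f₀ x v * φ 0 x v) -
          (∫ t in Set.Icc 0 T', ∫ x in cube, ∫ v, f t x v * ddt φ t x v) -
          (∫ t in Set.Icc 0 T', ∫ x in cube, ∫ v, f t x v * vGradX φ t x v)))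

/-- Iterated partial derivative `∂^α_x` in the space variable. -/
def pdX (i : Fin 3) (g : X3 → ℝ) : X3 → ℝ := fun x => fderiv ℝ g x (Pi.single i 1)

def pdMX (α : Fin 3 → ℕ) (g : X3 → ℝ) : X3 → ℝ :=
  (pdX 0)^[α 0] ((pdX 1)^[α 1] ((pdX 2)^[α 2] g))

/-- Iterated partial derivative `∂^α_v` in the velocity variable. -/
def pdV (i : Fin 3) (g : V3 → ℝ) : V3 → ℝ :=
  fun v => fderiv ℝ g v (EuclideanSpace.single i 1)

def pdMV (α : Fin 3 → ℕ) (g : V3 → ℝ) : V3 → ℝ :=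
  (pdV 0)^[α 0] ((pdV 1)^[α 1] ((pdV 2)^[α 2] g))

/-- Order `|α|` of a multi-index. -/
def mOrder (α : Fin 3 → ℕ) : ℕ := α 0 + α 1 + α 2

/-- `g` is the weak derivative `∂^α_x u` on `T³×ℝ³` (against smooth test functions). -/
def HasWeakDerivX (α : Fin 3 → ℕ) (u g : X3 → V3 → ℝ) : Prop :=
  Measurable (fun p : X3 × V3 => g p.1 p.2) ∧
  ∀ φ : X3 → V3 → ℝ, TestXV0 φ →
    Integrable (fun p : X3 × V3 => g p.1 p.2 * φ p.1 p.2) tvMeas ∧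
    (∫ x in cube, ∫ v, u x v * pdMX α (fun y => φ y v) x) =
      (-1 : ℝ) ^ mOrder α * ∫ x in cube, ∫ v, g x v * φ x v

/-- `g` is the weak derivative `∂^α_v u` on `T³×ℝ³` (against smooth test functions). -/
def HasWeakDerivV (α : Fin 3 → ℕ) (u g : X3 → V3 → ℝ) : Prop :=
  Measurable (fun p : X3 × V3 => g p.1 p.2) ∧
  ∀ φ : X3 → V3 → ℝ, TestXV0 φ →
    Integrable (fun p : X3 × V3 => g p.1 p.2 * φ p.1 p.2) tvMeas ∧
    (∫ x in cube, ∫ v, u x v * pdMV α (φ x) v) =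
      (-1 : ℝ) ^ mOrder α * ∫ x in cube, ∫ v, g x v * φ x v

/-- Weighted `L¹_x L¹_w` norm `∫∫ |g| ⟨v⟩^w`. -/
def wL1 (w : ℝ) (g : X3 → V3 → ℝ) : ℝ≥0∞ :=
  ∫⁻ x in cube, ∫⁻ v, ENNReal.ofReal (|g x v| * jap v ^ w)

/-- `⟨D_x⟩^a`, defined through the Fourier series in `x`. -/
def DxPowX (a : ℝ) (g : X3 → ℂ) : X3 → ℂ :=
  fun x => ∑' m : Fin 3 → ℤ, (japZ m ^ a : ℝ) • ((∫ y in cube, (eX m y)⁻¹ * g y) * eX m x)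

/-- `⟨D_v⟩^r`, defined through the Fourier transform in `v`. -/
def DvPow (r : ℝ) (g : V3 → ℂ) : V3 → ℂ :=
  𝓕⁻ fun ξ => (jap ξ ^ r : ℝ) • 𝓕 g ξ

/-- The normalized Gaussian `μ(v) = e^{-|v|²/2}/(2π)^{3/2}`. -/
def stdGauss (v : V3) : ℝ := Real.exp (-‖v‖ ^ 2 / 2) / (2 * π) ^ ((3 : ℝ) / 2)


/-- Smooth compactly supported test functions on `ℝ³_v`. -/
structure TestV (φ : V3 → ℝ) : Prop where
  smooth : ContDiff ℝ ((⊤ : ℕ∞) : WithTop ℕ∞) φ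
  compactV : ∃ R : ℝ, ∀ v, R ≤ ‖v‖ → φ v = 0

/-- `g` is the weak derivative `∂^α_v u` on `ℝ³` (spatially homogeneous setting). -/
def HasWeakDerivV1 (α : Fin 3 → ℕ) (u g : V3 → ℝ) : Prop :=
  Measurable g ∧ ∀ φ : V3 → ℝ, TestV φ →
    Integrable (fun v => g v * φ v) ∧
    (∫ v, u v * pdMV α φ v) = (-1 : ℝ) ^ mOrder α * ∫ v, g v * φ v

/-- Strong solution (in the distributional sense, with the collision term interpreted
through the cutoff limit) of the Boltzmann equation on `(0,T)×T³×ℝ³`, together with the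
macroscopic bounds `m₀ ≤ ρ ≤ M₀`, `E ≤ E₀`, `H ≤ H₀`. -/
structure StrongSol (γ : ℝ) (b : ℝ → ℝ) (T : ℝ) (f : ℝ → X3 → V3 → ℝ)
    (m₀ M₀ E₀ H₀ : ℝ) : Prop where
  nonneg : ∀ t x v, 0 ≤ f t x v
  meas : Measurable fun p : ℝ × X3 × V3 => f p.1 p.2.1 p.2.2
  periodicX : ∀ (t : ℝ) (k : Fin 3 → ℤ) (x : X3) (v : V3),
    f t (x + fun i => (k i : ℝ)) v = f t x v
  pde : ∀ φ : ℝ → X3 → V3 → ℝ, TestXVIn (Set.Ioo 0 T) φ →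
    Tendsto (fun ε : ℝ => ∫ t in Set.Ioo 0 T, ∫ x in cube, ∫ v,
        Qeps γ b ε (f t x) (f t x) v * φ t x v) (𝓝[>] 0)
      (𝓝 (-(∫ t in Set.Ioo 0 T, ∫ x in cube, ∫ v,
        f t x v * (ddt φ t x v + vGradX φ t x v))))
  massLB : ∀ t ∈ Set.Ioo (0 : ℝ) T, ∀ x, m₀ ≤ ∫ v, f t x v
  massUB : ∀ t ∈ Set.Ioo (0 : ℝ) T, ∀ x, (∫ v, f t x v) ≤ M₀
  energyUB : ∀ t ∈ Set.Ioo (0 : ℝ) T, ∀ x, (∫ v, f t x v * ‖v‖ ^ 2) ≤ E₀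
  entropyUB : ∀ t ∈ Set.Ioo (0 : ℝ) T, ∀ x, (∫ v, f t x v * Real.log (f t x v)) ≤ H₀

/-- Solution (in the distributional sense, with the collision terms interpreted through
the cutoff limit) of the linear Boltzmann equation `∂_t h + v·∇_x h = Q(μ,h) + Q(h,μ)`. -/
structure LinearSol (γ : ℝ) (b : ℝ → ℝ) (T : ℝ) (h : ℝ → X3 → V3 → ℝ) : Prop where
  meas : Measurable fun p : ℝ × X3 × V3 => h p.1 p.2.1 p.2.2
  periodicX : ∀ (t : ℝ) (k : Fin 3 → ℤ) (x : X3) (v : V3),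
    h t (x + fun i => (k i : ℝ)) v = h t x v
  pde : ∀ φ : ℝ → X3 → V3 → ℝ, TestXVIn (Set.Ioo 0 T) φ →
    Tendsto (fun ε : ℝ => ∫ t in Set.Ioo 0 T, ∫ x in cube, ∫ v,
        (Qeps γ b ε stdGauss (h t x) v + Qeps γ b ε (h t x) stdGauss v) * φ t x v)
      (𝓝[>] 0)
      (𝓝 (-(∫ t in Set.Ioo 0 T, ∫ x in cube, ∫ v,
        h t x v * (ddt φ t x v + vGradX φ t x v))))

/-- Cutoff pairing `⟨Q_ε(g,h), f⟩` for complex-valued functions. -/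
def QpairEps (γ : ℝ) (b : ℝ → ℝ) (ε : ℝ) (g h f : V3 → ℂ) : ℂ :=
  ∫ v, ∫ vs, (∫ σ, (if ⟪‖v - vs‖⁻¹ • (v - vs), σ⟫ ≤ Real.cos ε then
      (Bker γ b (v - vs) σ : ℂ) * (g (vsPost v vs σ) * h (vPost v vs σ) - g vs * h v) * f v
    else 0) ∂sphMeas)

/-- Embedding of integer frequencies into `ℝ³`. -/
def mV (m : Fin 3 → ℤ) : V3 := (WithLp.equiv 2 (Fin 3 → ℝ)).symm fun i => (m i : ℝ)

/-- Fourier transform on `ℝ³ × ℝ³`. -/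
def FT6 (g : V3 → V3 → ℂ) (m ξ : V3) : ℂ :=
  ∫ x : V3, ∫ v : V3,
    Complex.exp (((-(2 * π * (⟪x, m⟫ + ⟪v, ξ⟫)) : ℝ) : ℂ) * Complex.I) * g x v

/-- The Fourier multiplier operator `T_M` on `ℝ³ × ℝ³` with symbol `M`. -/
def TMop (M : V3 → V3 → ℂ) (g : V3 → V3 → ℂ) (x v : V3) : ℂ :=
  ∫ m : V3, ∫ ξ : V3,
    Complex.exp (((2 * π * (⟪x, m⟫ + ⟪v, ξ⟫) : ℝ) : ℂ) * Complex.I) * (M m ξ * FT6 g m ξ)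

/-- Mixed Fourier transform on `T³ × ℝ³`. -/
def FTmix (f : X3 → V3 → ℂ) (m : Fin 3 → ℤ) (ξ : V3) : ℂ :=
  ∫ x in cube, ∫ v : V3,
    (eX m x)⁻¹ * (Complex.exp (((-(2 * π * ⟪v, ξ⟫) : ℝ) : ℂ) * Complex.I) * f x v)

/-- The multiplier operator `S_M` on `T³ × ℝ³` with symbol `M(m,ξ)`, `m ∈ ℤ³`. -/
def SMop (M : V3 → V3 → ℂ) (f : X3 → V3 → ℂ) (x : X3) (v : V3) : ℂ :=
  ∑' m : Fin 3 → ℤ, eX m x *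
    ∫ ξ : V3, Complex.exp (((2 * π * ⟪v, ξ⟫ : ℝ) : ℂ) * Complex.I) * (M (mV m) ξ * FTmix f m ξ)

lemma exists_int_abs_sub_le_of_abs_sin_lt {y η : ℝ} (h : |sin y| < η) :
    |y - round (y / π) * π| ≤ π / 2 * η := by
  have hπ := Real.pi_pos
  set k : ℤ := round (y / π)
  have h1 : |y - k * π| ≤ π / 2 := by
    have h2 : y - k * π = (y / π - k) * π := by field_simp
    rw [h2, abs_mul, abs_of_pos hπ]
    nlinarith [abs_sub_round (y / π)]
  have h3 := Real.mul_abs_le_abs_sin h1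
  have h4 : |sin (y - k * π)| = |sin y| := by
    rw [Real.sin_sub_int_mul_pi, abs_mul, abs_zpow]
    simp
  rw [h4] at h3
  have h5 : 2 / π * |y - k * π| ≤ η := h3.trans h.le
  have h6 : |y - k * π| = π / 2 * (2 / π * |y - k * π|) := by field_simp
  rw [h6]
  gcongr

lemma volume_abs_sin_lt_le {s R δ : ℝ} (φ : ℝ) (hs : 0 < s) (hR : 1 ≤ R) (hδ : 0 ≤ δ) :
    volume {t : ℝ | |t| ≤ R ∧ |sin (π * (s * t) + φ)| < min s 1 * δ} ≤
      ENNReal.ofReal (4 * R * δ) := by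
  have hπ := Real.pi_pos
  set η := min s 1 * δ with hη
  have hη0 : 0 ≤ η := by positivity
  have hη1 : η ≤ δ := by
    have := min_le_right s 1
    nlinarith
  have hη2 : η ≤ s * δ := by
    have := min_le_left s 1
    nlinarith
  set a := -(s * R) + φ / π - 1 / 2 with ha
  set b := s * R + φ / π + 1 / 2 with hb
  set c : ℤ → ℝ := fun k => (k - φ / π) / s with hc
  have hsub : {t : ℝ | |t| ≤ R ∧ |sin (π * (s * t) + φ)| < η} ⊆
      ⋃ k ∈ Finset.Icc ⌈a⌉ ⌊b⌋, Set.Icc (c k - η / (2 * s)) (c k + η / (2 * s)) := by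
    rintro t ⟨ht, hsin⟩
    have h1 := exists_int_abs_sub_le_of_abs_sin_lt hsin
    have h2 := abs_sub_round ((π * (s * t) + φ) / π)
    set k := round ((π * (s * t) + φ) / π)
    have h3 : (π * (s * t) + φ) / π = s * t + φ / π := by field_simp
    rw [h3, abs_le] at h2
    rw [abs_le] at ht
    simp only [Set.mem_iUnion, Finset.mem_Icc, Set.mem_Icc]
    refine ⟨k, ⟨Int.ceil_le.2 ?_, Int.le_floor.2 ?_⟩, ?_⟩
    · rw [ha]; nlinarith
    · rw [hb]; nlinarith
    · have h4 : |t - c k| ≤ η / (2 * s) := by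
        have h5 : π * (s * t) + φ - k * π = (π * s) * (t - c k) := by
          simp only [hc]; field_simp; ring
        rw [h5, abs_mul, abs_of_pos (by positivity)] at h1
        rw [le_div_iff₀ (by positivity)]
        have h6 : π * (|t - c k| * (2 * s)) ≤ π * η := by linarith
        exact le_of_mul_le_mul_left h6 hπ
      rw [abs_le] at h4
      constructor <;> linarith
  have hcard : ((Finset.Icc ⌈a⌉ ⌊b⌋).card : ℝ) ≤ 2 * s * R + 2 := by
    rw [Int.card_Icc]
    have h1 : ((⌊b⌋ + 1 - ⌈a⌉).toNat : ℝ) = ((max (⌊b⌋ + 1 - ⌈a⌉) 0 : ℤ) : ℝ) :=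
      congrArg (Int.cast : ℤ → ℝ) (Int.toNat_eq_max _)
    rw [h1]
    push_cast
    refine max_le ?_ (by positivity)
    linarith [Int.floor_le b, Int.le_ceil a]
  calc _ ≤ volume (⋃ k ∈ Finset.Icc ⌈a⌉ ⌊b⌋,
          Set.Icc (c k - η / (2 * s)) (c k + η / (2 * s))) := measure_mono hsub
    _ ≤ ∑ k ∈ Finset.Icc ⌈a⌉ ⌊b⌋,
          volume (Set.Icc (c k - η / (2 * s)) (c k + η / (2 * s))) :=
        measure_biUnion_finset_le _ _
    _ = ∑ k ∈ Finset.Icc ⌈a⌉ ⌊b⌋, ENNReal.ofReal (η / s) := by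
        refine Finset.sum_congr rfl fun k _ => ?_
        rw [Real.volume_Icc]
        congr 1
        field_simp
        ring
    _ = ENNReal.ofReal ((Finset.Icc ⌈a⌉ ⌊b⌋).card * (η / s)) := by
        rw [Finset.sum_const, nsmul_eq_mul, ENNReal.ofReal_mul (by positivity),
          ENNReal.ofReal_natCast]
    _ ≤ ENNReal.ofReal (4 * R * δ) := by
        apply ENNReal.ofReal_le_ofReal
        have h1 : η / s ≤ δ := by rw [div_le_iff₀ hs]; linarith
        calc _ ≤ (2 * s * R + 2) * (η / s) := by gcongr
          _ = 2 * R * η + 2 * (η / s) := by field_simp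
          _ ≤ 2 * R * δ + 2 * δ := by gcongr
          _ ≤ 4 * R * δ := by nlinarith

lemma volume_ball_inter_slabs_le {ξ : V3} {R δ : ℝ} (φ : ℝ) (hξ : ξ ≠ 0) (hR : 1 ≤ R)
    (hδ : 0 ≤ δ) :
    volume {v : V3 | ‖v‖ ≤ R ∧ |sin (π * ⟪v, ξ⟫ + φ)| < min ‖ξ‖ 1 * δ} ≤
      ENNReal.ofReal (16 * R ^ 3 * δ) := by
  have hs : 0 < ‖ξ‖ := norm_pos_iff.2 hξ
  obtain ⟨b, hb⟩ : ∃ b : OrthonormalBasis (Fin 3) ℝ V3, b 0 = ‖ξ‖⁻¹ • ξ := by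
    obtain ⟨b, hb⟩ := Orthonormal.exists_orthonormalBasis_extension_of_card_eq (𝕜 := ℝ) (E := V3)
      (ι := Fin 3) (by simp) (v := fun _ => ‖ξ‖⁻¹ • ξ) (s := {0})
      ⟨fun _ => by simp [Set.domRestrict, norm_smul, hs.ne'], fun i j hij =>
        (hij (Subsingleton.elim i j)).elim⟩
    exact ⟨b, hb 0 rfl⟩
  set T : Set ℝ := {t : ℝ | |t| ≤ R ∧ |sin (π * (‖ξ‖ * t) + φ)| < min ‖ξ‖ 1 * δ} with hT
  have hTm : MeasurableSet T := by
    refine (measurableSet_le (f := fun t : ℝ => |t|) ?_ measurable_const).inter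
      (measurableSet_lt (f := fun t : ℝ => |sin (π * (‖ξ‖ * t) + φ)|) ?_ measurable_const) <;>
    fun_prop
  set S : Fin 3 → Set ℝ := ![T, Set.Icc (-R) R, Set.Icc (-R) R] with hS
  have hSm : MeasurableSet (Set.univ.pi S) := by
    refine MeasurableSet.univ_pi fun i => ?_
    fin_cases i
    · exact hTm
    · exact measurableSet_Icc
    · exact measurableSet_Icc
  have hmp := (EuclideanSpace.volume_preserving_symm_measurableEquiv_toLp (Fin 3)).comp
    b.measurePreserving_repr
  have hsub : {v : V3 | ‖v‖ ≤ R ∧ |sin (π * ⟪v, ξ⟫ + φ)| < min ‖ξ‖ 1 * δ} ⊆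
      (⇑(MeasurableEquiv.toLp 2 (Fin 3 → ℝ)).symm ∘ ⇑b.repr) ⁻¹' Set.univ.pi S := by
    rintro v ⟨hv, hsin⟩
    have hcoord : ∀ i, |(b.repr v) i| ≤ R := fun i =>
      ((PiLp.norm_apply_le (b.repr v) i).trans_eq (b.repr.norm_map v)).trans hv
    have h0 : ‖ξ‖ * (b.repr v) 0 = ⟪v, ξ⟫ := by
      rw [b.repr_apply_apply, hb, real_inner_smul_left, real_inner_comm]
      field_simp
    intro i _
    fin_cases i
    · exact ⟨hcoord 0, by rw [← h0] at hsin; exact hsin⟩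
    · exact abs_le.1 (hcoord 1)
    · exact abs_le.1 (hcoord 2)
  calc _ ≤ volume ((⇑(MeasurableEquiv.toLp 2 (Fin 3 → ℝ)).symm ∘ ⇑b.repr) ⁻¹' Set.univ.pi S) :=
        measure_mono hsub
    _ = volume (Set.univ.pi S) := hmp.measure_preimage hSm.nullMeasurableSet
    _ = volume T * ENNReal.ofReal (2 * R) * ENNReal.ofReal (2 * R) := by
        rw [volume_pi_pi, Fin.prod_univ_three]
        have h2 : R - -R = 2 * R := by ring
        simp [hS, h2]
    _ ≤ ENNReal.ofReal (4 * R * δ) * ENNReal.ofReal (2 * R) * ENNReal.ofReal (2 * R) := by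
        gcongr
        exact volume_abs_sin_lt_le φ hs hR hδ
    _ = ENNReal.ofReal (16 * R ^ 3 * δ) := by
        rw [← ENNReal.ofReal_mul (by positivity), ← ENNReal.ofReal_mul (by positivity)]
        congr 1
        ring

lemma jap_pos (v : V3) : 0 < jap v := Real.sqrt_pos.2 (by positivity)

lemma one_le_jap (v : V3) : 1 ≤ jap v := Real.one_le_sqrt.2 (by nlinarith [sq_nonneg ‖v‖])

lemma norm_le_jap (v : V3) : ‖v‖ ≤ jap v := Real.le_sqrt_of_sq_le (by linarith)

lemma measurable_jap : Measurable jap := by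
  unfold jap
  fun_prop

/-- Cauchy–Schwarz against the weight `⟨v⟩³`. -/
lemma lintegral_mul_le_of_wLp_le {M : ℝ} {f : V3 → ℝ} (hf : Measurable f) (hf0 : ∀ v, 0 ≤ f v)
    (hfM : wLp 2 3 (toC1 f) ≤ ENNReal.ofReal M) {h : V3 → ℝ≥0∞} (hh : Measurable h) :
    ∫⁻ v, ENNReal.ofReal (f v) * h v ≤
      ENNReal.ofReal M * (∫⁻ v, (ENNReal.ofReal (jap v ^ (-3 : ℝ)) * h v) ^ (2 : ℝ)) ^
        (1 / 2 : ℝ) := by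
  have hj := measurable_jap
  have h1 := ENNReal.lintegral_mul_le_Lp_mul_Lq (volume : Measure V3) Real.HolderConjugate.two_two
    (f := fun v => ENNReal.ofReal (jap v ^ (3 : ℝ) * f v))
    (g := fun v => ENNReal.ofReal (jap v ^ (-3 : ℝ)) * h v)
    (by fun_prop) (by fun_prop)
  have h2 : wLp 2 3 (toC1 f) =
      (∫⁻ v, ENNReal.ofReal (jap v ^ (3 : ℝ) * f v) ^ (2 : ℝ)) ^ (1 / 2 : ℝ) := by
    rw [wLp, eLpNorm_eq_lintegral_rpow_enorm_toReal (by simp) (by simp)]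
    simp only [ENNReal.toReal_ofNat]
    congr 1
    refine lintegral_congr fun v => ?_
    congr 1
    rw [← ofReal_norm, norm_smul, toC1, Complex.norm_real, Real.norm_of_nonneg (hf0 v),
      Real.norm_of_nonneg (Real.rpow_nonneg (jap_pos v).le _)]
  rw [← h2] at h1
  refine le_trans (le_of_eq (lintegral_congr fun v => ?_)) (h1.trans (by gcongr))
  have h3 : jap v ^ (3 : ℝ) * jap v ^ (-3 : ℝ) = 1 := by
    rw [← Real.rpow_add (jap_pos v)]; simp
  simp only [Pi.mul_apply]
  rw [← mul_assoc, ← ENNReal.ofReal_mul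
    (mul_nonneg (Real.rpow_nonneg (jap_pos v).le _) (hf0 v)), mul_right_comm, h3, one_mul]

lemma exists_first_moment_bound : ∃ K > (0 : ℝ), ∀ (M : ℝ) (f : V3 → ℝ), 0 < M → Measurable f →
    (∀ v, 0 ≤ f v) → wLp 2 3 (toC1 f) ≤ ENNReal.ofReal M →
    ∫⁻ v, ENNReal.ofReal (f v) * ENNReal.ofReal (jap v) ≤ ENNReal.ofReal (M * K) := by
  set I : ℝ≥0∞ := ∫⁻ v : V3, (ENNReal.ofReal (jap v ^ (-3 : ℝ)) * ENNReal.ofReal (jap v)) ^ (2 : ℝ)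
    with hI
  have hfin : I ≠ ⊤ := by
    have h1 : Integrable (fun v : V3 => (1 + ‖v‖ ^ 2) ^ (-(4 : ℝ) / 2)) :=
      integrable_rpow_neg_one_add_norm_sq (by simp; norm_num)
    have h2 : I = ∫⁻ v : V3, ENNReal.ofReal ((1 + ‖v‖ ^ 2) ^ (-(4 : ℝ) / 2)) := by
      refine lintegral_congr fun v => ?_
      have hp := jap_pos v
      rw [← ENNReal.ofReal_mul (by positivity), ENNReal.ofReal_rpow_of_nonneg (by positivity)
        (by norm_num)]
      congr 1
      have h3 : jap v ^ (-3 : ℝ) * jap v = jap v ^ (-2 : ℝ) := by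
        rw [← Real.rpow_add_one hp.ne']; norm_num
      rw [h3, ← Real.rpow_mul hp.le, jap, Real.sqrt_eq_rpow, ← Real.rpow_mul (by positivity)]
      norm_num
    rw [h2]
    exact h1.lintegral_lt_top.ne
  refine ⟨(I ^ (1 / 2 : ℝ)).toReal + 1, by positivity, fun M f hM hf hf0 hfM => ?_⟩
  refine (lintegral_mul_le_of_wLp_le hf hf0 hfM (h := fun v => ENNReal.ofReal (jap v))
    (ENNReal.measurable_ofReal.comp measurable_jap)).trans ?_
  rw [ENNReal.ofReal_mul hM.le]
  gcongr
  rw [← hI]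
  refine (ENNReal.ofReal_toReal (ENNReal.rpow_ne_top_of_nonneg (by norm_num) hfin)).symm.le.trans ?_
  exact ENNReal.ofReal_le_ofReal (by linarith)

lemma lintegral_indicator_le_of_wLp_le {M : ℝ} {f : V3 → ℝ} (hf : Measurable f)
    (hf0 : ∀ v, 0 ≤ f v) (hfM : wLp 2 3 (toC1 f) ≤ ENNReal.ofReal M) {A : Set V3}
    (hA : MeasurableSet A) :
    ∫⁻ v, ENNReal.ofReal (f v) * A.indicator 1 v ≤ ENNReal.ofReal M * volume A ^ (1 / 2 : ℝ) := by
  refine (lintegral_mul_le_of_wLp_le hf hf0 hfM (measurable_one.indicator hA)).trans ?_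
  gcongr
  rw [← lintegral_indicator_one hA]
  refine lintegral_mono fun v => ?_
  by_cases hv : v ∈ A
  · have h1 : jap v ^ (-3 : ℝ) ≤ 1 :=
      Real.rpow_le_one_of_one_le_of_nonpos (one_le_jap v) (by norm_num)
    have h2 : ENNReal.ofReal (jap v ^ (-3 : ℝ)) ≤ 1 := ENNReal.ofReal_le_one.2 h1
    simpa [hv] using ENNReal.rpow_le_one h2 (zero_le_two (α := ℝ))
  · simp [hv]

/-- The Fourier gap equals `2 ∫ f sin²` for a suitable phase. -/
lemma exists_fourier_gap_eq {f : V3 → ℝ} (hf : Integrable f) (ξ : V3) :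
    ∃ φ : ℝ, (𝓕 (toC1 f) 0).re - ‖𝓕 (toC1 f) ξ‖ =
      2 * ∫ v, f v * sin (π * ⟪v, ξ⟫ + φ) ^ 2 := by
  obtain ⟨z, hz⟩ : ∃ z, z = 𝓕 (toC1 f) ξ := ⟨_, rfl⟩
  rw [← hz]
  refine ⟨z.arg / 2, ?_⟩
  have h0 : (𝓕 (toC1 f) 0).re = ∫ v, f v := by
    rw [Real.fourier_eq']
    simp only [inner_zero_right, mul_zero, Complex.ofReal_zero, zero_mul, Complex.exp_zero,
      one_smul, toC1]
    rw [integral_complex_ofReal, Complex.ofReal_re]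
  have hmeas : AEStronglyMeasurable (fun v : V3 => cos (2 * (π * ⟪v, ξ⟫ + z.arg / 2))) :=
    Continuous.aestronglyMeasurable (by fun_prop)
  have hcos : Integrable (fun v : V3 => f v * cos (2 * (π * ⟪v, ξ⟫ + z.arg / 2))) :=
    hf.mul_bdd (c := 1) hmeas (ae_of_all _ fun v => by simpa using Real.abs_cos_le_one _)
  have h1 : ‖z‖ = ∫ v, f v * cos (2 * (π * ⟪v, ξ⟫ + z.arg / 2)) := by
    have h2 : (‖z‖ : ℂ) = Complex.exp (((-z.arg : ℝ) : ℂ) * Complex.I) * z := by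
      conv_rhs => rw [← Complex.norm_mul_exp_arg_mul_I z]
      rw [mul_left_comm, Complex.norm_mul_exp_arg_mul_I, ← Complex.exp_add]
      simp
    have hg : Integrable (fun v : V3 => Complex.exp (((-z.arg : ℝ) : ℂ) * Complex.I) *
        (Complex.exp (((-2 * π * ⟪v, ξ⟫ : ℝ) : ℂ) * Complex.I) • toC1 f v)) := by
      apply Integrable.const_mul
      refine Integrable.bdd_mul (c := 1) hf.ofReal
        (Continuous.aestronglyMeasurable (by fun_prop)) (ae_of_all _ fun v => ?_)
      rw [Complex.norm_exp_ofReal_mul_I]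
    rw [Real.fourier_eq'] at hz
    rw [← Complex.ofReal_re ‖z‖, h2]
    nth_rewrite 2 [hz]
    rw [← integral_const_mul]
    refine (integral_re hg).symm.trans (integral_congr_ae (ae_of_all _ fun v => ?_))
    simp only [smul_eq_mul, toC1]
    rw [← mul_assoc, ← Complex.exp_add, ← add_mul, ← Complex.ofReal_add]
    rw [RCLike.re_eq_complex_re, Complex.re_mul_ofReal, Complex.exp_ofReal_mul_I_re, mul_comm,
      ← Real.cos_neg]
    congr 2
    ring
  rw [h0, h1, ← integral_sub hf hcos, ← integral_const_mul]
  refine integral_congr_ae (ae_of_all _ fun v => ?_)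
  simp only
  rw [Real.cos_two_mul, Real.cos_sq']
  ring

/-- Splitting the mass into the far field, the slabs where the sine is small, and the rest. -/
lemma integral_le_of_slab_decomposition {M K R δ : ℝ} (hM : 0 < M) (hK : 0 < K) (hR : 1 ≤ R)
    (hδ : 0 < δ) {f : V3 → ℝ} (hf : Measurable f) (hf0 : ∀ v, 0 ≤ f v) (hfi : Integrable f)
    (hfM : wLp 2 3 (toC1 f) ≤ ENNReal.ofReal M)
    (hfK : ∫⁻ v, ENNReal.ofReal (f v) * ENNReal.ofReal (jap v) ≤ ENNReal.ofReal (M * K))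
    {ξ : V3} (hξ : ξ ≠ 0) (φ : ℝ) :
    ∫ v, f v ≤ M * K / R + M * (16 * R ^ 3 * δ) ^ (1 / 2 : ℝ) +
      (∫ v, f v * sin (π * ⟪v, ξ⟫ + φ) ^ 2) / (min ‖ξ‖ 1 * δ) ^ 2 := by
  have hs : 0 < ‖ξ‖ := norm_pos_iff.2 hξ
  set η := min ‖ξ‖ 1 * δ with hη
  have hη0 : 0 < η := by positivity
  set A : Set V3 := {v | ‖v‖ ≤ R ∧ |sin (π * ⟪v, ξ⟫ + φ)| < η} with hA
  have hAm : MeasurableSet A := by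
    refine (measurableSet_le (f := fun v : V3 => ‖v‖) ?_ measurable_const).inter
      (measurableSet_lt (f := fun v : V3 => |sin (π * ⟪v, ξ⟫ + φ)|) ?_ measurable_const) <;>
    fun_prop
  have hAvol : volume A ≤ ENNReal.ofReal (16 * R ^ 3 * δ) :=
    volume_ball_inter_slabs_le φ hξ hR hδ.le
  have hsin0 : ∀ v, 0 ≤ f v * sin (π * ⟪v, ξ⟫ + φ) ^ 2 := fun v =>
    mul_nonneg (hf0 v) (sq_nonneg _)
  have hsini : Integrable (fun v => f v * sin (π * ⟪v, ξ⟫ + φ) ^ 2) :=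
    hfi.mul_bdd (c := 1) (Continuous.aestronglyMeasurable (by fun_prop))
      (ae_of_all _ fun v => by
        rw [Real.norm_of_nonneg (sq_nonneg _)]
        exact Real.sin_sq_le_one _)
  have hj := measurable_jap
  have hpt : ∀ v, ENNReal.ofReal (f v) ≤
      (ENNReal.ofReal (f v) * ENNReal.ofReal (jap v)) * ENNReal.ofReal R⁻¹ +
        ENNReal.ofReal (f v) * A.indicator 1 v +
        ENNReal.ofReal (f v * sin (π * ⟪v, ξ⟫ + φ) ^ 2 / η ^ 2) := by
    intro v
    by_cases hv : ‖v‖ ≤ R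
    · by_cases hvs : |sin (π * ⟪v, ξ⟫ + φ)| < η
      · have hvA : v ∈ A := ⟨hv, hvs⟩
        refine le_trans ?_ (le_trans le_add_self le_self_add)
        simp [hvA]
      · refine le_trans (ENNReal.ofReal_le_ofReal ?_) le_add_self
        rw [le_div_iff₀ (by positivity)]
        have h1 : η ^ 2 ≤ sin (π * ⟪v, ξ⟫ + φ) ^ 2 := by
          rw [← sq_abs (sin _)]
          have := not_lt.1 hvs
          gcongr
        exact mul_le_mul_of_nonneg_left h1 (hf0 v)
    · refine le_trans ?_ (le_trans le_self_add le_self_add)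
      rw [← ENNReal.ofReal_mul (hf0 v), ← ENNReal.ofReal_mul
        (mul_nonneg (hf0 v) (jap_pos v).le)]
      apply ENNReal.ofReal_le_ofReal
      rw [← div_eq_mul_inv, le_div_iff₀ (by positivity)]
      exact mul_le_mul_of_nonneg_left ((not_le.1 hv).le.trans (norm_le_jap v)) (hf0 v)
  have hmain : ENNReal.ofReal (∫ v, f v) ≤ ENNReal.ofReal (M * K / R +
      M * (16 * R ^ 3 * δ) ^ (1 / 2 : ℝ) + (∫ v, f v * sin (π * ⟪v, ξ⟫ + φ) ^ 2) / η ^ 2) := by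
    rw [ENNReal.ofReal_add (by positivity) (div_nonneg (integral_nonneg hsin0) (by positivity)),
      ENNReal.ofReal_add (by positivity) (by positivity),
      ofReal_integral_eq_lintegral_ofReal hfi (ae_of_all _ hf0)]
    refine (lintegral_mono hpt).trans ?_
    rw [lintegral_add_left (by fun_prop), lintegral_add_left (by fun_prop),
      lintegral_mul_const _ (by fun_prop)]
    gcongr
    · rw [div_eq_mul_inv, ENNReal.ofReal_mul (by positivity)]
      gcongr
    · refine (lintegral_indicator_le_of_wLp_le hf hf0 hfM hAm).trans ?_
      rw [ENNReal.ofReal_mul hM.le, ← ENNReal.ofReal_rpow_of_nonneg (by positivity) (by norm_num)]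
      gcongr
    · rw [← integral_div, ofReal_integral_eq_lintegral_ofReal (hsini.div_const _)
        (ae_of_all _ fun v => div_nonneg (hsin0 v) (by positivity))]
  exact (ENNReal.ofReal_le_ofReal_iff (by
    have h1 : 0 ≤ ∫ v, f v * sin (π * ⟪v, ξ⟫ + φ) ^ 2 := integral_nonneg hsin0
    positivity)).1 hmain

/-- Lemma 4.1: quantitative lower bound for the Fourier transform gap
`F(f)(0) - |F(f)(ξ)| ≥ C_M ‖f‖₁^{11}(|ξ|² 1_{|ξ|≤1} + 1_{|ξ|>1})`. -/
theorem statement15 (M : ℝ) (hM : 0 < M) :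
    ∃ C > (0 : ℝ), ∀ f : V3 → ℝ, Measurable f → (∀ v, 0 ≤ f v) →
      wLp 2 3 (toC1 f) ≤ ENNReal.ofReal M →
      ∀ ξ : V3, C * (∫ v, f v) ^ (11 : ℕ) * (if ‖ξ‖ ≤ 1 then ‖ξ‖ ^ 2 else 1) ≤
        (𝓕 (toC1 f) 0).re - ‖𝓕 (toC1 f) ξ‖ := by
  obtain ⟨K, hK, hmom⟩ := exists_first_moment_bound
  refine ⟨((2 ^ 14 * M ^ 5 * K ^ 3) ^ 2)⁻¹, by positivity, fun f hf hf0 hfM ξ => ?_⟩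
  have hfK := hmom M f hM hf hf0 hfM
  have hle : ∫⁻ v, ENNReal.ofReal (f v) ≤ ENNReal.ofReal (M * K) := by
    refine (lintegral_mono fun v => ?_).trans hfK
    exact le_mul_of_one_le_right' (ENNReal.one_le_ofReal.2 (one_le_jap v))
  have hfi : Integrable f :=
    ⟨hf.aestronglyMeasurable, (hasFiniteIntegral_iff_ofReal (ae_of_all _ hf0)).2
      (hle.trans_lt ENNReal.ofReal_lt_top)⟩
  obtain ⟨φ, hφ⟩ := exists_fourier_gap_eq hfi ξ
  rw [hφ]
  have hS : 0 ≤ ∫ v, f v * sin (π * ⟪v, ξ⟫ + φ) ^ 2 :=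
    integral_nonneg fun v => mul_nonneg (hf0 v) (sq_nonneg _)
  have hm0 : 0 ≤ ∫ v, f v := integral_nonneg hf0
  have hmK : ∫ v, f v ≤ M * K := by
    rw [← ofReal_integral_eq_lintegral_ofReal hfi (ae_of_all _ hf0)] at hle
    exact (ENNReal.ofReal_le_ofReal_iff (by positivity)).1 hle
  rcases hm0.eq_or_lt with hm | hm
  · rw [← hm]
    simpa using hS
  by_cases hξ : ξ = 0
  · simpa [hξ] using hS
  have hs : 0 < ‖ξ‖ := norm_pos_iff.2 hξ
  have hmin : (if ‖ξ‖ ≤ 1 then ‖ξ‖ ^ 2 else 1) = (min ‖ξ‖ 1) ^ 2 := by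
    split_ifs with h
    · rw [min_eq_left h]
    · rw [min_eq_right (not_le.1 h).le, one_pow]
  rw [hmin]
  set m := ∫ v, f v
  set S := ∫ v, f v * sin (π * ⟪v, ξ⟫ + φ) ^ 2
  set R := 4 * M * K / m with hR
  set δ := m ^ 5 / (2 ^ 14 * M ^ 5 * K ^ 3) with hδ
  have hR1 : 1 ≤ R := by
    rw [hR, one_le_div hm]
    nlinarith
  have hδ0 : 0 < δ := by positivity
  have hsplit : m ≤ M * K / R + M * (16 * R ^ 3 * δ) ^ (1 / 2 : ℝ) + S / (min ‖ξ‖ 1 * δ) ^ 2 :=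
    integral_le_of_slab_decomposition hM hK hR1 hδ0 hf hf0 hfi hfM hfK hξ φ
  have h1 : M * K / R = m / 4 := by
    rw [hR]; field_simp
  have h2 : M * (16 * R ^ 3 * δ) ^ (1 / 2 : ℝ) = m / 4 := by
    have h3 : 16 * R ^ 3 * δ = (m / (4 * M)) ^ 2 := by
      rw [hR, hδ]; field_simp; norm_num
    rw [h3, ← Real.sqrt_eq_rpow, Real.sqrt_sq (by positivity)]
    field_simp
  rw [h1, h2] at hsplit
  have h3 : m / 2 ≤ S / (min ‖ξ‖ 1 * δ) ^ 2 := by linarith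
  rw [le_div_iff₀ (by positivity)] at h3
  have h4 : ((2 ^ 14 * M ^ 5 * K ^ 3) ^ 2)⁻¹ * m ^ 11 * min ‖ξ‖ 1 ^ 2 =
      2 * (m / 2 * (min ‖ξ‖ 1 * δ) ^ 2) := by
    rw [hδ]; field_simp
  rw [h4]
  linarith
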